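/- Assume r ∈ [0,1] is fixed, α is strictly increasing on (a,b), β ∈ BV_loc((a,b),ℝ), and θ_{1−r}(x) ≠ 0 and θ_r(x) ≠ 0 for all x ∈ (a,b). Let u be a nontrivial real-valued r-balanced solution of −d(dy/dα) + y dβ = 0 on (a,b). Then u does not change sign in (a,b) if and only if either u > 0 on (a,b) or u < 0 on (a,b). -/

import Mathlib

open Set Filter Function MeasureTheory Topology

noncomputable section

/-- The open interval `(a,b) ⊆ ℝ` determined by extended-real endpoints `a`, `b`. -/
def EI (a b : EReal) : Set ℝ := {x : ℝ | a < (x : EReal) ∧ (x : EReal) < b}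

/-- The jump `Δ_{df}(x) = f⁺(x) - f⁻(x)` of a real-valued function. -/
def jump (f : ℝ → ℝ) (x : ℝ) : ℝ := rightLim f x - leftLim f x

/-- The jump `Δ_{df}(x) = f⁺(x) - f⁻(x)` of a complex-valued function. -/
def jumpC (f : ℝ → ℂ) (x : ℝ) : ℂ := rightLim f x - leftLim f x

/-- `θ_z(x) = 1 - z² Δ_{dα}(x) Δ_{dβ}(x)`. -/
def theta (α β : ℝ → ℝ) (z x : ℝ) : ℝ := 1 - z ^ 2 * jump α x * jump β x

/-- `ω(x) = 1 - Δ_{dα}(x) Δ_{dβ}(x) / 4`. -/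
def omegaFn (α β : ℝ → ℝ) (x : ℝ) : ℝ := 1 - jump α x * jump β x / 4

/-- A real-valued function is `r`-balanced on `I`: it is of locally bounded variation and
`f(x) = r f⁻(x) + (1-r) f⁺(x)` for all `x ∈ I`. -/
def RBalanced (r : ℝ) (I : Set ℝ) (f : ℝ → ℝ) : Prop :=
  LocallyBoundedVariationOn f I ∧
    ∀ x ∈ I, f x = r * leftLim f x + (1 - r) * rightLim f x

/-- A complex-valued function is `r`-balanced on `I`. -/
def RBalancedC (r : ℂ) (I : Set ℝ) (f : ℝ → ℂ) : Prop :=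
  LocallyBoundedVariationOn f I ∧
    ∀ x ∈ I, f x = r * leftLim f x + (1 - r) * rightLim f x

/-- `ν` coincides on `[c,d]` with the Lebesgue–Stieltjes measure `df` generated by `f`,
determined by `df((x,y]) = f⁺(y) - f⁺(x)`. -/
def SMRepresents (ν : SignedMeasure ℝ) (f : ℝ → ℝ) (c d : ℝ) : Prop :=
  ∀ x ∈ Icc c d, ∀ y ∈ Icc c d, x ≤ y → ν (Ioc x y) = rightLim f y - rightLim f x

/-- The integral of `h` against the signed measure `ν` over the set `E`. -/
def sInt (ν : SignedMeasure ℝ) (h : ℝ → ℝ) (E : Set ℝ) : ℝ :=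
  (∫ x in E, h x ∂ν.toJordanDecomposition.posPart) -
    (∫ x in E, h x ∂ν.toJordanDecomposition.negPart)

/-- The equality of (locally finite, real Borel) measures `dg = ∑ j, (h j) d(β j)` on the
interval `I`, expressed via localizations to compact subintervals of `I`. -/
def MeasureEqOn (I : Set ℝ) {ι : Type} [Fintype ι] (g : ℝ → ℝ) (h β : ι → ℝ → ℝ) : Prop :=
  ∀ c ∈ I, ∀ d ∈ I, c < d →
    ∃ (νg : SignedMeasure ℝ) (ν : ι → SignedMeasure ℝ),
      SMRepresents νg g c d ∧ (∀ j, SMRepresents (ν j) (β j) c d) ∧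
      ∀ E : Set ℝ, E ⊆ Ioc c d → MeasurableSet E → νg E = ∑ j, sInt (ν j) (h j) E

/-- The equality of complex measures `dg = ∑ j, (h j) d(β j)` on `I`, encoded via real and
imaginary parts. -/
def MeasureEqOnC (I : Set ℝ) {ι : Type} [Fintype ι] (g : ℝ → ℂ) (h β : ι → ℝ → ℂ) : Prop :=
  MeasureEqOn I (fun x => (g x).re)
    (Sum.elim (fun j x => (h j x).re) (fun j x => -(h j x).im))
    (Sum.elim (fun j x => (β j x).re) (fun j x => (β j x).im)) ∧
  MeasureEqOn I (fun x => (g x).im)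
    (Sum.elim (fun j x => (h j x).im) (fun j x => (h j x).re))
    (Sum.elim (fun j x => (β j x).re) (fun j x => (β j x).im))

/-- The support of `dα` is all of `I`: no open subinterval of `I` is `dα`-null, i.e. on no
open subinterval of `I` do all one-sided limits of `α` coincide with a single constant. -/
def SuppFull (I : Set ℝ) (α : ℝ → ℂ) : Prop :=
  ∀ x ∈ I, ∀ ε > (0 : ℝ), Icc (x - ε) (x + ε) ⊆ I →
    ¬ (∀ p ∈ Ioo (x - ε) (x + ε), ∀ q ∈ Ioo (x - ε) (x + ε),
        rightLim α p = rightLim α q ∧ leftLim α p = rightLim α q)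

/-- `u`, together with the representative `w` of `du/dα`, is an `r`-balanced solution of the
homogeneous equation `-d(du/dα) + u dβ = 0` on `I`: `u` and `w` are `r`-balanced,
`du = w dα` (so `du ≪ dα` with `du/dα = w`), and `dw = u dβ`. -/
def IsHomSol (I : Set ℝ) (r : ℝ) (α β u w : ℝ → ℝ) : Prop :=
  RBalanced r I u ∧ RBalanced r I w ∧
  MeasureEqOn I u (fun _ : Fin 1 => w) (fun _ => α) ∧
  MeasureEqOn I w (fun _ : Fin 1 => u) (fun _ => β)

/-- `u`, together with the representative `w` of `du/dα`, is an `r`-balanced solution of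
`-d(du/dα) + u dβ = dη` on `I` (complex-valued coefficients): `dw = u dβ - dη`. -/
def IsSolC (I : Set ℝ) (r : ℂ) (α β η u w : ℝ → ℂ) : Prop :=
  RBalancedC r I u ∧ RBalancedC r I w ∧
  MeasureEqOnC I u (fun _ : Fin 1 => w) (fun _ => α) ∧
  MeasureEqOnC I w ![u, fun _ => (-1 : ℂ)] ![β, η]

/-- `y` solves the linear system `dy = dφ · y + dψ` on `I`, componentwise:
`d(y i) = ∑ j, (y j) d(φ i j) + dψ i`. -/
def IsSysSolC (I : Set ℝ) (n : ℕ) (φ : ℝ → Matrix (Fin n) (Fin n) ℂ)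
    (ψ : ℝ → Fin n → ℂ) (y : ℝ → Fin n → ℂ) : Prop :=
  ∀ i : Fin n,
    MeasureEqOnC I (fun x => y x i)
      (Sum.elim (fun j : Fin n => fun x => y x j) (fun _ : Unit => fun _ => (1 : ℂ)))
      (Sum.elim (fun j : Fin n => fun x => φ x i j) (fun _ : Unit => fun x => ψ x i))

/-- `Z_I(f) = {x ∈ I : f⁻(x) f⁺(x) ≤ 0}`, the set of sign-changing points of `f` in `I`. -/
def ZSet (f : ℝ → ℝ) (I : Set ℝ) : Set ℝ := {x ∈ I | leftLim f x * rightLim f x ≤ 0}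

/-- `u` changes sign at `s ∈ I`. -/
def ChangesSignAt (I : Set ℝ) (u : ℝ → ℝ) (s : ℝ) : Prop :=
  ∃ δ > (0 : ℝ), Ioo (s - δ) (s + δ) ⊆ I ∧
    (((∀ x ∈ Ioo (s - δ) s, leftLim u x < 0) ∧ ∀ x ∈ Ioo s (s + δ), 0 < rightLim u x) ∨
     ((∀ x ∈ Ioo (s - δ) s, 0 < leftLim u x) ∧ ∀ x ∈ Ioo s (s + δ), rightLim u x < 0))

/-- `u` changes sign in `J` (a subinterval of `I`). -/
def ChangesSignIn (I : Set ℝ) (u : ℝ → ℝ) (J : Set ℝ) : Prop :=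
  ∃ s ∈ J, ChangesSignAt I u s

/-- `u` and `v` are linearly dependent on `I`. -/
def LinDepOn (I : Set ℝ) (u v : ℝ → ℝ) : Prop :=
  ∃ c₁ c₂ : ℝ, ¬(c₁ = 0 ∧ c₂ = 0) ∧ ∀ x ∈ I, c₁ * u x + c₂ * v x = 0

/-- The Lebesgue–Stieltjes measure `dg` is nonnegative on (Borel subsets of) `S`, expressed by
nonnegativity on all subintervals of `S` of each of the four kinds. -/
def PosMeasureOn (g : ℝ → ℝ) (S : Set ℝ) : Prop :=
  (∀ x y : ℝ, x ≤ y → Icc x y ⊆ S → 0 ≤ rightLim g y - leftLim g x) ∧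
  (∀ x y : ℝ, x ≤ y → Ico x y ⊆ S → 0 ≤ leftLim g y - leftLim g x) ∧
  (∀ x y : ℝ, x ≤ y → Ioc x y ⊆ S → 0 ≤ rightLim g y - rightLim g x) ∧
  (∀ x y : ℝ, x < y → Ioo x y ⊆ S → 0 ≤ leftLim g y - rightLim g x)

/-! ### One-sided limits -/

theorem leftLim_mem_of_isClosed {f : ℝ → ℝ} {O C : Set ℝ} (hO : IsOpen O) (hC : IsClosed C)
    (h : ∀ z ∈ O, f z ∈ C) {x : ℝ} (hx : x ∈ O) : leftLim f x ∈ C :=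
  hC.mem_of_mapClusterPt (mapClusterPt_leftLim f x)
    (mem_nhdsWithin_of_mem_nhds (mem_of_superset (hO.mem_nhds hx) h))

theorem rightLim_mem_of_isClosed {f : ℝ → ℝ} {O C : Set ℝ} (hO : IsOpen O) (hC : IsClosed C)
    (h : ∀ z ∈ O, f z ∈ C) {x : ℝ} (hx : x ∈ O) : rightLim f x ∈ C :=
  hC.mem_of_mapClusterPt (mapClusterPt_rightLim f x)
    (mem_nhdsWithin_of_mem_nhds (mem_of_superset (hO.mem_nhds hx) h))

theorem tendsto_of_forall_isClosed {f g : ℝ → ℝ} {s : Set ℝ} (hs : IsOpen s) {x L : ℝ}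
    (hfg : ∀ O C : Set ℝ, IsOpen O → IsClosed C → (∀ z ∈ O, f z ∈ C) → ∀ z ∈ O, g z ∈ C)
    (h : Tendsto f (𝓝[s] x) (𝓝 L)) : Tendsto g (𝓝[s] x) (𝓝 L) := by
  refine (closed_nhds_basis L).tendsto_right_iff.2 ?_
  rintro C ⟨hC, hCc⟩
  obtain ⟨O, hO, hxO, hOs⟩ := mem_nhdsWithin.1 (h hC)
  filter_upwards [inter_mem (mem_nhdsWithin_of_mem_nhds (hO.mem_nhds hxO)) self_mem_nhdsWithin]
    with z hz using hfg (O ∩ s) C (hO.inter hs) hCc hOs z hz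

theorem Filter.Tendsto.rightLim_nhdsWithin {f : ℝ → ℝ} {s : Set ℝ} (hs : IsOpen s) {x L : ℝ}
    (h : Tendsto f (𝓝[s] x) (𝓝 L)) : Tendsto (rightLim f) (𝓝[s] x) (𝓝 L) :=
  tendsto_of_forall_isClosed hs
    (fun _ _ hO hC hz _ hx => rightLim_mem_of_isClosed hO hC hz hx) h

theorem Filter.Tendsto.leftLim_nhdsWithin {f : ℝ → ℝ} {s : Set ℝ} (hs : IsOpen s) {x L : ℝ}
    (h : Tendsto f (𝓝[s] x) (𝓝 L)) : Tendsto (leftLim f) (𝓝[s] x) (𝓝 L) :=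
  tendsto_of_forall_isClosed hs
    (fun _ _ hO hC hz _ hx => leftLim_mem_of_isClosed hO hC hz hx) h

theorem IsOpen.exists_Icc_subset {I : Set ℝ} (hI : IsOpen I) {x : ℝ} (hx : x ∈ I) :
    ∃ δ > 0, Icc (x - δ) (x + δ) ⊆ I := by
  obtain ⟨δ, hδ, h⟩ := Metric.isOpen_iff.1 hI x hx
  refine ⟨δ / 2, by positivity, fun y hy => h ?_⟩
  rw [Real.ball_eq_Ioo]
  exact ⟨by linarith [hy.1], by linarith [hy.2]⟩

theorem LocallyBoundedVariationOn.tendsto_leftLim {f : ℝ → ℝ} {I : Set ℝ}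
    (hf : LocallyBoundedVariationOn f I) (hI : IsOpen I) {x : ℝ} (hx : x ∈ I) :
    Tendsto f (𝓝[<] x) (𝓝 (leftLim f x)) := by
  obtain ⟨δ, hδ, h⟩ := hI.exists_Icc_subset hx
  refine tendsto_leftLim_of_tendsto ?_
  obtain ⟨l, hl⟩ := (hf (x - δ) (x + δ) (h ⟨by linarith, by linarith⟩)
    (h ⟨by linarith, by linarith⟩)).exists_tendsto_left x
  refine ⟨l, hl.mono_left (nhdsWithin_le_iff.2 ?_)⟩
  filter_upwards [Ioo_mem_nhdsLT (show x - δ < x by linarith)] with z hz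
  exact ⟨⟨h ⟨hz.1.le, by linarith [hz.2]⟩, hz.1.le, by linarith [hz.2]⟩, hz.2⟩

theorem LocallyBoundedVariationOn.tendsto_rightLim {f : ℝ → ℝ} {I : Set ℝ}
    (hf : LocallyBoundedVariationOn f I) (hI : IsOpen I) {x : ℝ} (hx : x ∈ I) :
    Tendsto f (𝓝[>] x) (𝓝 (rightLim f x)) := by
  obtain ⟨δ, hδ, h⟩ := hI.exists_Icc_subset hx
  refine tendsto_rightLim_of_tendsto ?_
  obtain ⟨l, hl⟩ := (hf (x - δ) (x + δ) (h ⟨by linarith, by linarith⟩)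
    (h ⟨by linarith, by linarith⟩)).exists_tendsto_right x
  refine ⟨l, hl.mono_left (nhdsWithin_le_iff.2 ?_)⟩
  filter_upwards [Ioo_mem_nhdsGT (show x < x + δ by linarith)] with z hz
  exact ⟨⟨h ⟨by linarith [hz.1], hz.2.le⟩, by linarith [hz.1], hz.2.le⟩, hz.1⟩

/-! ### Signed measures representing Lebesgue–Stieltjes measures -/

theorem SMRepresents.apply_singleton {ν : SignedMeasure ℝ} {f : ℝ → ℝ} {c d x : ℝ}
    (hν : SMRepresents ν f c d) (hx : x ∈ Ioc c d)
    (hf : Tendsto f (𝓝[<] x) (𝓝 (leftLim f x))) : ν {x} = jump f x := by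
  obtain ⟨v, hvm, hv, hvt⟩ := exists_seq_strictMono_tendsto' hx.1
  have hinter : (⋂ n, Ioc (v n) x) = {x} := by
    refine Subset.antisymm (fun z hz => ?_) (fun z hz => ?_)
    · rw [mem_iInter] at hz
      exact le_antisymm (hz 0).2 (le_of_tendsto' hvt fun n => (hz n).1.le)
    · rw [mem_singleton_iff.1 hz]
      exact mem_iInter.2 fun n => ⟨(hv n).2, le_rfl⟩
  have h1 := VectorMeasure.tendsto_vectorMeasure_iInter_atTop_nat (v := ν)
    (s := fun n => Ioc (v n) x) (fun m n hmn => Ioc_subset_Ioc_left (hvm.monotone hmn))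
    (fun n => measurableSet_Ioc)
  rw [hinter] at h1
  have h2 : Tendsto (fun n => rightLim f x - rightLim f (v n)) atTop (𝓝 (jump f x)) :=
    tendsto_const_nhds.sub ((hf.rightLim_nhdsWithin isOpen_Iio).comp
      (tendsto_nhdsWithin_iff.2 ⟨hvt, Eventually.of_forall fun n => (hv n).2⟩))
  refine tendsto_nhds_unique h1 (h2.congr fun n => ?_)
  exact (hν _ ⟨(hv n).1.le, (hv n).2.le.trans hx.2⟩ _ ⟨hx.1.le, hx.2⟩ (hv n).2.le).symm

theorem sInt_singleton (ν : SignedMeasure ℝ) (h : ℝ → ℝ) (x : ℝ) :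
    sInt ν h {x} = h x * ν {x} := by
  rw [sInt, integral_singleton, integral_singleton,
    ν.apply_eq_posPart_real_sub_negPart_real (measurableSet_singleton x)]
  simp only [smul_eq_mul]
  ring

theorem sInt_neg (ν : SignedMeasure ℝ) (h : ℝ → ℝ) (E : Set ℝ) :
    sInt ν (fun x => -h x) E = -sInt ν h E := by
  simp only [sInt, integral_neg]
  ring

theorem abs_sInt_le {ν : SignedMeasure ℝ} {h : ℝ → ℝ} {E : Set ℝ} {M : ℝ}
    (hM : ∀ z ∈ E, |h z| ≤ M) : |sInt ν h E| ≤ M * ν.totalVariation.real E := by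
  have h1 := norm_setIntegral_le_of_norm_le_const
    (μ := ν.toJordanDecomposition.posPart) (f := h) (s := E) (measure_lt_top _ _) hM
  have h2 := norm_setIntegral_le_of_norm_le_const
    (μ := ν.toJordanDecomposition.negPart) (f := h) (s := E) (measure_lt_top _ _) hM
  have h3 : ν.totalVariation.real E = ν.toJordanDecomposition.posPart.real E
      + ν.toJordanDecomposition.negPart.real E := by
    rw [SignedMeasure.totalVariation, measureReal_add_apply]
  rw [h3, mul_add]
  exact (abs_sub _ _).trans (add_le_add h1 h2)

theorem exists_measureReal_le_of_antitone (μ : Measure ℝ) [IsFiniteMeasure μ] {s : ℝ → Set ℝ}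
    (hs : ∀ t, MeasurableSet (s t)) (hm : Monotone s) (he : ⋂ t > 0, s t = ∅) {ε : ℝ}
    (hε : 0 < ε) {η : ℝ} (hη : 0 < η) : ∃ t > 0, t < η ∧ μ.real (s t) ≤ ε := by
  have h := tendsto_measure_biInter_gt (μ := μ) (s := s) (a := (0 : ℝ))
    (fun t _ => (hs t).nullMeasurableSet) (fun i j _ hij => hm hij)
    ⟨1, one_pos, measure_ne_top _ _⟩
  rw [he, measure_empty] at h
  have h' := (h.eventually (ge_mem_nhds (ENNReal.ofReal_pos.2 hε))).and (Ioo_mem_nhdsGT hη)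
  obtain ⟨t, ht, ht0⟩ := h'.exists
  exact ⟨t, ht0.1, ht0.2, ENNReal.toReal_le_of_le_ofReal hε.le ht⟩

theorem exists_Ioo_right_measureReal_le (μ : Measure ℝ) [IsFiniteMeasure μ] (x : ℝ) {ε : ℝ}
    (hε : 0 < ε) {η : ℝ} (hη : 0 < η) : ∃ t > 0, t < η ∧ μ.real (Ioo x (x + t)) ≤ ε := by
  refine exists_measureReal_le_of_antitone μ (fun t => measurableSet_Ioo)
    (fun s t hst => Ioo_subset_Ioo_right (by linarith)) ?_ hε hη
  refine eq_empty_of_forall_notMem fun z hz => ?_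
  simp only [mem_iInter, mem_Ioo] at hz
  have := (hz 1 one_pos).1
  linarith [(hz (z - x) (by linarith)).2]

theorem exists_Ioo_left_measureReal_le (μ : Measure ℝ) [IsFiniteMeasure μ] (x : ℝ) {ε : ℝ}
    (hε : 0 < ε) {η : ℝ} (hη : 0 < η) : ∃ t > 0, t < η ∧ μ.real (Ioo (x - t) x) ≤ ε := by
  refine exists_measureReal_le_of_antitone μ (fun t => measurableSet_Ioo)
    (fun s t hst => Ioo_subset_Ioo_left (by linarith)) ?_ hε hη
  refine eq_empty_of_forall_notMem fun z hz => ?_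
  simp only [mem_iInter, mem_Ioo] at hz
  have := (hz 1 one_pos).2
  linarith [(hz (x - z) (by linarith)).1]

theorem SMRepresents.negPart_Ioc_eq_zero {ν : SignedMeasure ℝ} {f : ℝ → ℝ} {c d c' d' : ℝ}
    (hν : SMRepresents ν f c d) (hf : MonotoneOn f (Icc c' d')) (hc : c' < c) (hcd : c < d)
    (hd : d < d') : ν.toJordanDecomposition.negPart (Ioc c d) = 0 := by
  set P := ν.toJordanDecomposition.posPart
  set N := ν.toJordanDecomposition.negPart
  have hcd' : c' ≤ d' := by linarith
  have hF : Monotone (IccExtend hcd' (fun z => f z)) :=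
    Monotone.IccExtend (f := fun z : Icc c' d' => f z) hcd' fun x y hxy => hf x.2 y.2 hxy
  have hlim : ∀ x ∈ Icc c d, rightLim (IccExtend hcd' (fun z => f z)) x = rightLim f x := by
    intro x hx
    have hev : IccExtend hcd' (fun z => f z) =ᶠ[𝓝[>] x] f := by
      filter_upwards [Ioo_mem_nhdsGT (show x < d' by linarith [hx.2])] with z hz
      exact IccExtend_of_mem hcd' (fun z : Icc c' d' => f z)
        (show z ∈ Icc c' d' from ⟨by linarith [hx.1, hz.1], hz.2.le⟩)
    exact (rightLim_eq_of_tendsto ((hF.tendsto_rightLim x).congr' hev)).symm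
  have hmeas : P.restrict (Ioc c d) = (hF.stieltjesFunction.measure + N).restrict (Ioc c d) := by
    refine Measure.ext_of_Ioc _ _ fun x y _ => ?_
    rw [Measure.restrict_apply measurableSet_Ioc, Measure.restrict_apply measurableSet_Ioc,
      Ioc_inter_Ioc, Measure.add_apply, StieltjesFunction.measure_Ioc]
    rcases le_or_gt (max x c) (min y d) with hxy | hxy
    · have hx' : max x c ∈ Icc c d := ⟨le_max_right _ _, hxy.trans (min_le_right _ _)⟩
      have hy' : min y d ∈ Icc c d := ⟨(le_max_right _ _).trans hxy, min_le_right _ _⟩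
      have h1 := hν _ hx' _ hy' hxy
      rw [ν.apply_eq_posPart_real_sub_negPart_real measurableSet_Ioc] at h1
      rw [hF.stieltjesFunction_eq, hF.stieltjesFunction_eq, hlim _ hx', hlim _ hy']
      have h2 : 0 ≤ rightLim f (min y d) - rightLim f (max x c) := by
        rw [← hlim _ hx', ← hlim _ hy']
        exact sub_nonneg.2 (hF.rightLim hxy)
      rw [← ofReal_measureReal (μ := P), ← ofReal_measureReal (μ := N),
        ← ENNReal.ofReal_add h2 measureReal_nonneg]
      congr 1
      linarith
    · rw [Ioc_eq_empty (not_lt.2 hxy.le), measure_empty, measure_empty, add_zero,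
        ENNReal.ofReal_of_nonpos (sub_nonpos.2 (hF.stieltjesFunction.mono hxy.le))]
  obtain ⟨S, hS, hPS, hNS⟩ := ν.toJordanDecomposition.mutuallySingular
  have h0 : N (S ∩ Ioc c d) = 0 := by
    have h := congrArg (fun μ : Measure ℝ => μ S) hmeas
    simp only [Measure.restrict_apply hS, Measure.add_apply] at h
    rw [measure_mono_null inter_subset_left hPS, eq_comm, add_eq_zero] at h
    exact h.2
  have h1 : N (Sᶜ ∩ Ioc c d) = 0 := measure_mono_null inter_subset_left hNS
  refine measure_mono_null (fun z hz => ?_) (measure_union_null h0 h1)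
  exact (em (z ∈ S)).imp (fun h => ⟨h, hz⟩) (fun h => ⟨h, hz⟩)

theorem LocallyBoundedVariationOn.integrableOn_Ioc {f : ℝ → ℝ} {I : Set ℝ}
    (hf : LocallyBoundedVariationOn f I) {c d : ℝ} (hcd : Icc c d ⊆ I)
    (μ : Measure ℝ) [IsFiniteMeasure μ] : IntegrableOn f (Ioc c d) μ := by
  obtain ⟨p, q, hp, hq, rfl⟩ := hf.exists_monotoneOn_sub_monotoneOn
  exact ((hp.mono hcd).integrableOn_isCompact isCompact_Icc |>.sub
    ((hq.mono hcd).integrableOn_isCompact isCompact_Icc)).mono_set Ioc_subset_Icc_self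

theorem SMRepresents.sInt_Ioc_pos {ν : SignedMeasure ℝ} {f h : ℝ → ℝ} {I : Set ℝ} {c d c' d' : ℝ}
    (hν : SMRepresents ν f c d) (hf : MonotoneOn f (Icc c' d')) (hc : c' < c) (hcd : c < d)
    (hd : d < d') (hlt : rightLim f c < rightLim f d)
    (hh : LocallyBoundedVariationOn h I) (hI : Icc c d ⊆ I) (hpos : ∀ z ∈ Ioc c d, 0 < h z) :
    0 < sInt ν h (Ioc c d) := by
  have hN := hν.negPart_Ioc_eq_zero hf hc hcd hd
  have h1 := hν c ⟨le_rfl, hcd.le⟩ d ⟨hcd.le, le_rfl⟩ hcd.le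
  rw [ν.apply_eq_posPart_real_sub_negPart_real measurableSet_Ioc, measureReal_def (μ := _),
    measureReal_def, hN, ENNReal.toReal_zero, sub_zero] at h1
  have hP : 0 < ν.toJordanDecomposition.posPart (Ioc c d) := by
    refine pos_iff_ne_zero.2 fun h0 => ?_
    rw [h0, ENNReal.toReal_zero] at h1
    linarith
  rw [sInt, Measure.restrict_eq_zero.2 hN, integral_zero_measure, sub_zero]
  rw [setIntegral_pos_iff_support_of_nonneg_ae
    ((ae_restrict_mem measurableSet_Ioc).mono fun z hz => (hpos z hz).le)
    (hh.integrableOn_Ioc hI _)]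
  rwa [inter_eq_right.2 (show Ioc c d ⊆ support h from fun z hz => (hpos z hz).ne')]

theorem MeasureEqOn.jump_eq {I : Set ℝ} (hI : IsOpen I) {g h f : ℝ → ℝ}
    (hm : MeasureEqOn I g (fun _ : Fin 1 => h) (fun _ => f)) {x : ℝ} (hx : x ∈ I)
    (hg : Tendsto g (𝓝[<] x) (𝓝 (leftLim g x))) (hf : Tendsto f (𝓝[<] x) (𝓝 (leftLim f x))) :
    jump g x = h x * jump f x := by
  obtain ⟨δ, hδ, hδI⟩ := hI.exists_Icc_subset hx
  obtain ⟨νg, ν, hνg, hν, heq⟩ := hm (x - δ) (hδI ⟨le_rfl, by linarith⟩) x hx (by linarith)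
  have hxm : x ∈ Ioc (x - δ) x := ⟨by linarith, le_rfl⟩
  have h1 := heq {x} (singleton_subset_iff.2 hxm) (measurableSet_singleton x)
  rw [Fin.sum_univ_one, sInt_singleton, hνg.apply_singleton hxm hg,
    (hν 0).apply_singleton hxm hf] at h1
  exact h1

theorem MeasureEqOn.exists_increment_le {I : Set ℝ} {g h f : ℝ → ℝ}
    (hm : MeasureEqOn I g (fun _ : Fin 1 => h) (fun _ => f)) {c d : ℝ} (hc : c ∈ I) (hd : d ∈ I)
    (hcd : c < d) : ∃ μ : Measure ℝ, IsFiniteMeasure μ ∧ ∀ y ∈ Icc c d, ∀ z ∈ Icc c d, y ≤ z →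
      ∀ M, (∀ s ∈ Ioc y z, |h s| ≤ M) →
        |rightLim g z - rightLim g y| ≤ M * μ.real (Ioc y z) := by
  obtain ⟨νg, ν, hνg, hν, heq⟩ := hm c hc d hd hcd
  refine ⟨(ν 0).totalVariation, inferInstance, fun y hy z hz hyz M hM => ?_⟩
  rw [← hνg y hy z hz hyz, heq _ (Ioc_subset_Ioc hy.1 hz.2) measurableSet_Ioc, Fin.sum_univ_one]
  exact abs_sInt_le hM

theorem MeasureEqOn.exists_small_increment_right {I : Set ℝ} (hI : IsOpen I) {g h f : ℝ → ℝ}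
    (hm : MeasureEqOn I g (fun _ : Fin 1 => h) (fun _ => f)) {x : ℝ} (hx : x ∈ I) :
    ∃ t > 0, Icc x (x + t) ⊆ I ∧ ∀ y ∈ Ioo x (x + t), ∀ z ∈ Ioo x (x + t), y < z →
      ∀ M, (∀ s ∈ Ioc y z, |h s| ≤ M) → |rightLim g z - rightLim g y| ≤ M / 2 := by
  obtain ⟨δ, hδ, hδI⟩ := hI.exists_Icc_subset hx
  obtain ⟨μ, hμ, hinc⟩ := hm.exists_increment_le hx (hδI ⟨by linarith, le_rfl⟩)
    (show x < x + δ by linarith)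
  obtain ⟨t, ht0, htδ, ht⟩ := exists_Ioo_right_measureReal_le μ x (one_half_pos (α := ℝ)) hδ
  refine ⟨t, ht0, (Icc_subset_Icc (by linarith) (by linarith)).trans hδI,
    fun y hy z hz hyz M hM => ?_⟩
  refine (hinc y ⟨hy.1.le, by linarith [hy.2]⟩ z ⟨hz.1.le, by linarith [hz.2]⟩ hyz.le M hM).trans ?_
  have hM0 : 0 ≤ M := (abs_nonneg _).trans (hM z ⟨hyz, le_rfl⟩)
  have hsub : Ioc y z ⊆ Ioo x (x + t) := fun s hs => ⟨hy.1.trans hs.1, hs.2.trans_lt hz.2⟩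
  nlinarith [(measureReal_mono (μ := μ) hsub).trans ht]

theorem MeasureEqOn.exists_small_increment_left {I : Set ℝ} (hI : IsOpen I) {g h f : ℝ → ℝ}
    (hm : MeasureEqOn I g (fun _ : Fin 1 => h) (fun _ => f)) {x : ℝ} (hx : x ∈ I) :
    ∃ t > 0, Icc (x - t) x ⊆ I ∧ ∀ y ∈ Ioo (x - t) x, ∀ z ∈ Ioo (x - t) x, y < z →
      ∀ M, (∀ s ∈ Ioc y z, |h s| ≤ M) → |rightLim g z - rightLim g y| ≤ M / 2 := by
  obtain ⟨δ, hδ, hδI⟩ := hI.exists_Icc_subset hx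
  obtain ⟨μ, hμ, hinc⟩ := hm.exists_increment_le (hδI ⟨le_rfl, by linarith⟩) hx
    (show x - δ < x by linarith)
  obtain ⟨t, ht0, htδ, ht⟩ := exists_Ioo_left_measureReal_le μ x (one_half_pos (α := ℝ)) hδ
  refine ⟨t, ht0, (Icc_subset_Icc (by linarith) (by linarith)).trans hδI,
    fun y hy z hz hyz M hM => ?_⟩
  refine (hinc y ⟨by linarith [hy.1], hy.2.le⟩ z ⟨by linarith [hz.1], hz.2.le⟩ hyz.le M hM).trans ?_
  have hM0 : 0 ≤ M := (abs_nonneg _).trans (hM z ⟨hyz, le_rfl⟩)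
  have hsub : Ioc y z ⊆ Ioo (x - t) x := fun s hs => ⟨hy.1.trans hs.1, hs.2.trans_lt hz.2⟩
  nlinarith [(measureReal_mono (μ := μ) hsub).trans ht]

theorem rightLim_neg {f : ℝ → ℝ} {x : ℝ} (h : Tendsto f (𝓝[>] x) (𝓝 (rightLim f x))) :
    rightLim (fun z => -f z) x = -rightLim f x :=
  rightLim_eq_of_tendsto h.neg

theorem leftLim_neg {f : ℝ → ℝ} {x : ℝ} (h : Tendsto f (𝓝[<] x) (𝓝 (leftLim f x))) :
    leftLim (fun z => -f z) x = -leftLim f x :=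
  leftLim_eq_of_tendsto h.neg

theorem MeasureEqOn.neg {I : Set ℝ} (hI : I.OrdConnected) {g h f : ℝ → ℝ}
    (hg : ∀ x ∈ I, Tendsto g (𝓝[>] x) (𝓝 (rightLim g x)))
    (hm : MeasureEqOn I g (fun _ : Fin 1 => h) (fun _ => f)) :
    MeasureEqOn I (fun x => -g x) (fun _ : Fin 1 => fun x => -h x) (fun _ => f) := by
  intro c hc d hd hcd
  obtain ⟨νg, ν, hνg, hν, heq⟩ := hm c hc d hd hcd
  refine ⟨-νg, ν, fun x hx y hy hxy => ?_, hν, fun E hE hEm => ?_⟩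
  · rw [neg_apply, hνg x hx y hy hxy, rightLim_neg (hg x (hI.out hc hd hx)),
      rightLim_neg (hg y (hI.out hc hd hy))]
    ring
  · rw [neg_apply, heq E hE hEm, Fin.sum_univ_one, Fin.sum_univ_one, sInt_neg]

theorem RBalanced.neg {r : ℝ} {I : Set ℝ} (hI : IsOpen I) {f : ℝ → ℝ} (hf : RBalanced r I f) :
    RBalanced r I (fun x => -f x) := by
  refine ⟨(LipschitzWith.id (α := ℝ)).neg.comp_locallyBoundedVariationOn hf.1, fun x hx => ?_⟩
  rw [rightLim_neg (hf.1.tendsto_rightLim hI hx), leftLim_neg (hf.1.tendsto_leftLim hI hx)]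
  linear_combination -hf.2 x hx

/-! ### Homogeneous solutions on an open interval -/

/-- The standing assumptions: `u`, with `w` representing `du/dα`, solves the homogeneous equation
on the open interval `I`. -/
structure HomSolData (I : Set ℝ) (r : ℝ) (α β u w : ℝ → ℝ) : Prop where
  isOpen : IsOpen I
  ordConnected : I.OrdConnected
  r_mem : r ∈ Icc (0 : ℝ) 1
  strictMonoOn : StrictMonoOn α I
  bv : LocallyBoundedVariationOn β I
  theta_ne : ∀ x ∈ I, theta α β (1 - r) x ≠ 0 ∧ theta α β r x ≠ 0
  sol : IsHomSol I r α β u w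

namespace HomSolData

variable {I : Set ℝ} {r : ℝ} {α β u w : ℝ → ℝ} {x : ℝ}

theorem neg (H : HomSolData I r α β u w) :
    HomSolData I r α β (fun x => -u x) (fun x => -w x) where
  __ := H
  sol := ⟨H.sol.1.neg H.isOpen, H.sol.2.1.neg H.isOpen,
    H.sol.2.2.1.neg H.ordConnected fun _ hx => H.sol.1.1.tendsto_rightLim H.isOpen hx,
    H.sol.2.2.2.neg H.ordConnected fun _ hx => H.sol.2.1.1.tendsto_rightLim H.isOpen hx⟩

theorem bv_α (H : HomSolData I r α β u w) : LocallyBoundedVariationOn α I :=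
  H.strictMonoOn.monotoneOn.locallyBoundedVariationOn

theorem u_left (H : HomSolData I r α β u w) (hx : x ∈ I) :
    Tendsto u (𝓝[<] x) (𝓝 (leftLim u x)) := H.sol.1.1.tendsto_leftLim H.isOpen hx

theorem u_right (H : HomSolData I r α β u w) (hx : x ∈ I) :
    Tendsto u (𝓝[>] x) (𝓝 (rightLim u x)) := H.sol.1.1.tendsto_rightLim H.isOpen hx

theorem w_left (H : HomSolData I r α β u w) (hx : x ∈ I) :
    Tendsto w (𝓝[<] x) (𝓝 (leftLim w x)) := H.sol.2.1.1.tendsto_leftLim H.isOpen hx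

theorem w_right (H : HomSolData I r α β u w) (hx : x ∈ I) :
    Tendsto w (𝓝[>] x) (𝓝 (rightLim w x)) := H.sol.2.1.1.tendsto_rightLim H.isOpen hx

theorem jump_u (H : HomSolData I r α β u w) (hx : x ∈ I) :
    rightLim u x - leftLim u x = w x * jump α x :=
  H.sol.2.2.1.jump_eq H.isOpen hx (H.u_left hx) (H.bv_α.tendsto_leftLim H.isOpen hx)

theorem jump_w (H : HomSolData I r α β u w) (hx : x ∈ I) :
    rightLim w x - leftLim w x = u x * jump β x :=
  H.sol.2.2.2.jump_eq H.isOpen hx (H.w_left hx) (H.bv.tendsto_leftLim H.isOpen hx)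

theorem jump_α_nonneg (H : HomSolData I r α β u w) (hx : x ∈ I) : 0 ≤ jump α x := by
  have hL : leftLim α x ≤ α x := by
    refine le_of_tendsto (H.bv_α.tendsto_leftLim H.isOpen hx) ?_
    filter_upwards [mem_nhdsWithin_of_mem_nhds (H.isOpen.mem_nhds hx), self_mem_nhdsWithin]
      with z hz hzx using (H.strictMonoOn hz hx hzx).le
  have hR : α x ≤ rightLim α x := by
    refine ge_of_tendsto (H.bv_α.tendsto_rightLim H.isOpen hx) ?_
    filter_upwards [mem_nhdsWithin_of_mem_nhds (H.isOpen.mem_nhds hx), self_mem_nhdsWithin]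
      with z hz hzx using (H.strictMonoOn hx hz hzx).le
  exact sub_nonneg.2 (hL.trans hR)

theorem rightLim_α_lt (H : HomSolData I r α β u w) {y z : ℝ} (hy : y ∈ I) (hz : z ∈ I)
    (hyz : y < z) : rightLim α y < rightLim α z := by
  obtain ⟨s, hys, hsz⟩ := exists_between hyz
  have hs : s ∈ I := H.ordConnected.out hy hz ⟨hys.le, hsz.le⟩
  have h1 : rightLim α y ≤ α s := by
    refine le_of_tendsto (H.bv_α.tendsto_rightLim H.isOpen hy) ?_
    filter_upwards [Ioo_mem_nhdsGT hys] with t ht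
    exact (H.strictMonoOn (H.ordConnected.out hy hs ⟨ht.1.le, ht.2.le⟩) hs ht.2).le
  have h2 : α z ≤ rightLim α z := by
    refine ge_of_tendsto (H.bv_α.tendsto_rightLim H.isOpen hz) ?_
    filter_upwards [mem_nhdsWithin_of_mem_nhds (H.isOpen.mem_nhds hz), self_mem_nhdsWithin]
      with t ht hzt using (H.strictMonoOn hz ht hzt).le
  exact h1.trans_lt ((H.strictMonoOn hs hz hsz).trans_le h2)

theorem rightLim_u_strictMonoOn (H : HomSolData I r α β u w) {p q : ℝ} (hI : Ioo p q ⊆ I)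
    (hw : ∀ z ∈ Ioo p q, 0 < w z) : StrictMonoOn (rightLim u) (Ioo p q) := by
  intro y hy z hz hyz
  obtain ⟨νg, ν, hνg, hν, heq⟩ := H.sol.2.2.1 y (hI hy) z (hI hz) hyz
  obtain ⟨c', hc'⟩ := exists_between hy.1
  obtain ⟨d', hd'⟩ := exists_between hz.2
  have h1 : Icc c' d' ⊆ I := fun s hs => hI ⟨hc'.1.trans_le hs.1, hs.2.trans_lt hd'.2⟩
  have h2 := (hν 0).sInt_Ioc_pos (h := w) (I := I) (H.strictMonoOn.monotoneOn.mono h1) hc'.2 hyz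
    hd'.1 (H.rightLim_α_lt (hI hy) (hI hz) hyz) H.sol.2.1.1
    ((Icc_subset_Icc hc'.2.le hd'.1.le).trans h1)
    fun s hs => hw s ⟨hy.1.trans hs.1, hs.2.trans_lt hz.2⟩
  have h3 := heq _ Subset.rfl measurableSet_Ioc
  rw [Fin.sum_univ_one, hνg y ⟨le_rfl, hyz.le⟩ z ⟨hyz.le, le_rfl⟩ hyz.le] at h3
  linarith

theorem eq_zero_of_leftLim_eq_zero (H : HomSolData I r α β u w) (hx : x ∈ I)
    (hu : leftLim u x = 0) (hw : leftLim w x = 0) : u x = 0 ∧ w x = 0 := by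
  have h1 := H.jump_u hx
  have h2 := H.jump_w hx
  have h3 := H.sol.1.2 x hx
  have h4 := H.sol.2.1.2 x hx
  rw [hu] at h1 h3
  rw [hw] at h2 h4
  have h5 : u x * theta α β (1 - r) x = 0 := by
    rw [theta]
    linear_combination h3 + (1 - r) * h1 + (1 - r) * jump α x * h4
      + (1 - r) ^ 2 * jump α x * h2
  have h6 : u x = 0 := (mul_eq_zero.1 h5).resolve_right (H.theta_ne x hx).1
  rw [h6] at h2
  exact ⟨h6, by linear_combination h4 + (1 - r) * h2⟩

theorem eq_zero_of_rightLim_eq_zero (H : HomSolData I r α β u w) (hx : x ∈ I)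
    (hu : rightLim u x = 0) (hw : rightLim w x = 0) : u x = 0 ∧ w x = 0 := by
  have h1 := H.jump_u hx
  have h2 := H.jump_w hx
  have h3 := H.sol.1.2 x hx
  have h4 := H.sol.2.1.2 x hx
  rw [hu] at h1 h3
  rw [hw] at h2 h4
  have h5 : u x * theta α β r x = 0 := by
    rw [theta]
    linear_combination h3 - r * h1 - r * jump α x * h4 + r ^ 2 * jump α x * h2
  have h6 : u x = 0 := (mul_eq_zero.1 h5).resolve_right (H.theta_ne x hx).2
  rw [h6] at h2
  exact ⟨h6, by linear_combination h4 - r * h2⟩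

theorem lims_eq_of_eq_zero (H : HomSolData I r α β u w) (hx : x ∈ I) (hu : u x = 0) :
    leftLim w x = w x ∧ rightLim w x = w x := by
  have h2 := H.jump_w hx
  have h4 := H.sol.2.1.2 x hx
  rw [hu, zero_mul] at h2
  exact ⟨by linear_combination -h4 - (1 - r) * h2, by linear_combination -h4 + r * h2⟩

theorem lims_u_eq_zero (H : HomSolData I r α β u w) (hx : x ∈ I) (hu : u x = 0) (hw : w x = 0) :
    leftLim u x = 0 ∧ rightLim u x = 0 := by
  have h2 := H.jump_u hx
  have h4 := H.sol.1.2 x hx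
  rw [hw, zero_mul] at h2
  rw [hu] at h4
  exact ⟨by linear_combination -h4 - (1 - r) * h2, by linear_combination -h4 + r * h2⟩

end HomSolData

theorem abs_le_of_abs_rightLim_sub_le {r : ℝ} (hr : r ∈ Icc (0 : ℝ) 1) {J : Set ℝ}
    (hJ : IsOpen J) {l : Filter ℝ} [l.NeBot] {g : ℝ → ℝ} {K : ℝ}
    (hbal : RBalanced r J g) (hlim : Tendsto (rightLim g) l (𝓝 0))
    (hl : ∀ z ∈ J, ∀ᶠ y in l, |rightLim g z - rightLim g y| ≤ K) :
    ∀ z ∈ J, |g z| ≤ K := by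
  have hR : ∀ z ∈ J, |rightLim g z| ≤ K := fun z hz => by
    have h := le_of_tendsto (tendsto_const_nhds.sub hlim).abs (hl z hz)
    rwa [sub_zero] at h
  intro z hz
  have hL : |leftLim g z| ≤ K := by
    refine le_of_tendsto
      ((hbal.1.tendsto_leftLim hJ hz).rightLim_nhdsWithin isOpen_Iio).abs ?_
    filter_upwards [mem_nhdsWithin_of_mem_nhds (hJ.mem_nhds hz)] with y hy using hR y hy
  have hRz := abs_le.1 (hR z hz)
  have hLz := abs_le.1 hL
  rw [hbal.2 z hz, abs_le]
  constructor <;> nlinarith [hr.1, hr.2, hRz.1, hRz.2, hLz.1, hLz.2]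

theorem eq_zero_of_contracting {r : ℝ} (hr : r ∈ Icc (0 : ℝ) 1) {J : Set ℝ}
    (hJ : IsOpen J) {l : Filter ℝ} [l.NeBot] {u w : ℝ → ℝ}
    (hu : RBalanced r J u) (hw : RBalanced r J w)
    (hul : Tendsto (rightLim u) l (𝓝 0)) (hwl : Tendsto (rightLim w) l (𝓝 0))
    (hui : ∀ M, (∀ z ∈ J, |w z| ≤ M) →
      ∀ z ∈ J, ∀ᶠ y in l, |rightLim u z - rightLim u y| ≤ M / 2)
    (hwi : ∀ M, (∀ z ∈ J, |u z| ≤ M) →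
      ∀ z ∈ J, ∀ᶠ y in l, |rightLim w z - rightLim w y| ≤ M / 2)
    (hbu : ∃ M, ∀ z ∈ J, |u z| ≤ M) (hbw : ∃ M, ∀ z ∈ J, |w z| ≤ M) :
    ∀ z ∈ J, u z = 0 ∧ w z = 0 := by
  obtain ⟨A, hA⟩ := hbu
  obtain ⟨B, hB⟩ := hbw
  have key : ∀ n : ℕ, (∀ z ∈ J, |u z| ≤ max A B * (1 / 2) ^ n) ∧
      ∀ z ∈ J, |w z| ≤ max A B * (1 / 2) ^ n := by
    intro n
    induction n with
    | zero =>
      simp only [pow_zero, mul_one]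
      exact ⟨fun z hz => (hA z hz).trans (le_max_left _ _),
        fun z hz => (hB z hz).trans (le_max_right _ _)⟩
    | succ n ih =>
      have hpow : max A B * (1 / 2 : ℝ) ^ (n + 1) = max A B * (1 / 2) ^ n / 2 := by ring
      rw [hpow]
      exact ⟨abs_le_of_abs_rightLim_sub_le hr hJ hu hul (hui _ ih.2),
        abs_le_of_abs_rightLim_sub_le hr hJ hw hwl (hwi _ ih.1)⟩
  have hlim : Tendsto (fun n : ℕ => max A B * (1 / 2 : ℝ) ^ n) atTop (𝓝 0) := by
    simpa using (tendsto_pow_atTop_nhds_zero_of_lt_one (r := (1 / 2 : ℝ)) (by norm_num)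
      (by norm_num)).const_mul (max A B)
  exact fun z hz =>
    ⟨abs_nonpos_iff.1 (ge_of_tendsto' hlim fun n => (key n).1 z hz),
      abs_nonpos_iff.1 (ge_of_tendsto' hlim fun n => (key n).2 z hz)⟩

theorem LocallyBoundedVariationOn.exists_abs_le {f : ℝ → ℝ} {I : Set ℝ}
    (hf : LocallyBoundedVariationOn f I) {c d : ℝ} (hcd : c ≤ d) (hI : Icc c d ⊆ I) :
    ∃ M, ∀ z ∈ Icc c d, |f z| ≤ M := by
  have hb := hf c d (hI (left_mem_Icc.2 hcd)) (hI (right_mem_Icc.2 hcd))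
  refine ⟨|f c| + (eVariationOn f (I ∩ Icc c d)).toReal, fun z hz => ?_⟩
  have h := hb.dist_le ⟨hI hz, hz⟩ ⟨hI (left_mem_Icc.2 hcd), left_mem_Icc.2 hcd⟩
  rw [Real.dist_eq] at h
  linarith [abs_sub_abs_le_abs_sub (f z) (f c)]

theorem RBalanced.mono {r : ℝ} {I J : Set ℝ} {f : ℝ → ℝ} (hf : RBalanced r I f) (hJ : J ⊆ I) :
    RBalanced r J f :=
  ⟨fun a b ha hb => (hf.1 a b (hJ ha) (hJ hb)).mono (inter_subset_inter_left _ hJ),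
    fun x hx => hf.2 x (hJ hx)⟩

namespace HomSolData

variable {I : Set ℝ} {r : ℝ} {α β u w : ℝ → ℝ} {x : ℝ}

theorem eventually_right_eq_zero (H : HomSolData I r α β u w) (hx : x ∈ I)
    (hu : rightLim u x = 0) (hw : rightLim w x = 0) : ∀ᶠ z in 𝓝[>] x, u z = 0 ∧ w z = 0 := by
  obtain ⟨s, hs, hsI, hsu⟩ := H.sol.2.2.1.exists_small_increment_right H.isOpen hx
  obtain ⟨t, ht, htI, htw⟩ := H.sol.2.2.2.exists_small_increment_right H.isOpen hx
  have hm : 0 < min s t := lt_min hs ht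
  have hJs : Ioo x (x + min s t) ⊆ Ioo x (x + s) :=
    Ioo_subset_Ioo_right (by linarith [min_le_left s t])
  have hJt : Ioo x (x + min s t) ⊆ Ioo x (x + t) :=
    Ioo_subset_Ioo_right (by linarith [min_le_right s t])
  have hJI : Ioo x (x + min s t) ⊆ I := hJs.trans (Ioo_subset_Icc_self.trans hsI)
  have hbd : ∀ f : ℝ → ℝ, RBalanced r I f → ∃ M, ∀ z ∈ Ioo x (x + min s t), |f z| ≤ M :=
    fun f hf => (hf.1.exists_abs_le (by linarith) hsI).imp fun M hM z hz =>
      hM z (Ioo_subset_Icc_self (hJs hz))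
  filter_upwards [Ioo_mem_nhdsGT (show x < x + min s t by linarith)]
  refine eq_zero_of_contracting H.r_mem isOpen_Ioo (H.sol.1.mono hJI) (H.sol.2.1.mono hJI)
    (l := 𝓝[>] x) (hu ▸ (H.u_right hx).rightLim_nhdsWithin isOpen_Ioi)
    (hw ▸ (H.w_right hx).rightLim_nhdsWithin isOpen_Ioi) (fun M hM z hz => ?_)
    (fun M hM z hz => ?_) (hbd u H.sol.1) (hbd w H.sol.2.1)
  · filter_upwards [Ioo_mem_nhdsGT hz.1] with y hy
    exact hsu y (hJs ⟨hy.1, hy.2.trans hz.2⟩) z (hJs hz) hy.2 M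
      fun v hv => hM v ⟨hy.1.trans hv.1, hv.2.trans_lt hz.2⟩
  · filter_upwards [Ioo_mem_nhdsGT hz.1] with y hy
    exact htw y (hJt ⟨hy.1, hy.2.trans hz.2⟩) z (hJt hz) hy.2 M
      fun v hv => hM v ⟨hy.1.trans hv.1, hv.2.trans_lt hz.2⟩

theorem eventually_left_eq_zero (H : HomSolData I r α β u w) (hx : x ∈ I)
    (hu : leftLim u x = 0) (hw : leftLim w x = 0) : ∀ᶠ z in 𝓝[<] x, u z = 0 ∧ w z = 0 := by
  obtain ⟨s, hs, hsI, hsu⟩ := H.sol.2.2.1.exists_small_increment_left H.isOpen hx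
  obtain ⟨t, ht, htI, htw⟩ := H.sol.2.2.2.exists_small_increment_left H.isOpen hx
  have hm : 0 < min s t := lt_min hs ht
  have hJs : Ioo (x - min s t) x ⊆ Ioo (x - s) x :=
    Ioo_subset_Ioo_left (by linarith [min_le_left s t])
  have hJt : Ioo (x - min s t) x ⊆ Ioo (x - t) x :=
    Ioo_subset_Ioo_left (by linarith [min_le_right s t])
  have hJI : Ioo (x - min s t) x ⊆ I := hJs.trans (Ioo_subset_Icc_self.trans hsI)
  have hbd : ∀ f : ℝ → ℝ, RBalanced r I f → ∃ M, ∀ z ∈ Ioo (x - min s t) x, |f z| ≤ M :=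
    fun f hf => (hf.1.exists_abs_le (by linarith) hsI).imp fun M hM z hz =>
      hM z (Ioo_subset_Icc_self (hJs hz))
  filter_upwards [Ioo_mem_nhdsLT (show x - min s t < x by linarith)]
  refine eq_zero_of_contracting H.r_mem isOpen_Ioo (H.sol.1.mono hJI) (H.sol.2.1.mono hJI)
    (l := 𝓝[<] x) (hu ▸ (H.u_left hx).rightLim_nhdsWithin isOpen_Iio)
    (hw ▸ (H.w_left hx).rightLim_nhdsWithin isOpen_Iio) (fun M hM z hz => ?_)
    (fun M hM z hz => ?_) (hbd u H.sol.1) (hbd w H.sol.2.1)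
  · filter_upwards [Ioo_mem_nhdsLT hz.2] with y hy
    rw [abs_sub_comm]
    exact hsu z (hJs hz) y (hJs ⟨hz.1.trans hy.1, hy.2⟩) hy.1 M
      fun v hv => hM v ⟨hz.1.trans hv.1, hv.2.trans_lt hy.2⟩
  · filter_upwards [Ioo_mem_nhdsLT hz.2] with y hy
    rw [abs_sub_comm]
    exact htw z (hJt hz) y (hJt ⟨hz.1.trans hy.1, hy.2⟩) hy.1 M
      fun v hv => hM v ⟨hz.1.trans hv.1, hv.2.trans_lt hy.2⟩

/-- A solution with vanishing Cauchy data at one point vanishes identically. -/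
theorem eq_zero_of_eq_zero_at (H : HomSolData I r α β u w) (hx : x ∈ I) (hu : u x = 0)
    (hw : w x = 0) : ∀ z ∈ I, u z = 0 ∧ w z = 0 := by
  have hzero : ∀ z ∈ I, u z = 0 ∧ w z = 0 → ∀ᶠ y in 𝓝 z, u y = 0 ∧ w y = 0 := by
    intro z hz h0
    have hu0 := H.lims_u_eq_zero hz h0.1 h0.2
    have hw0 := H.lims_eq_of_eq_zero hz h0.1
    rw [h0.2] at hw0
    rw [← nhdsNE_sup_pure, ← nhdsLT_sup_nhdsGT, eventually_sup, eventually_sup]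
    exact ⟨⟨H.eventually_left_eq_zero hz hu0.1 hw0.1,
      H.eventually_right_eq_zero hz hu0.2 hw0.2⟩, h0⟩
  have hlim : ∀ z ∈ I, ¬ (u z = 0 ∧ w z = 0) → ∀ᶠ y in 𝓝 z, ¬ (u y = 0 ∧ w y = 0) := by
    intro z hz h0
    rw [← nhdsNE_sup_pure, ← nhdsLT_sup_nhdsGT, eventually_sup, eventually_sup]
    refine ⟨⟨?_, ?_⟩, h0⟩
    · by_cases hul : leftLim u z = 0
      · have hwl : leftLim w z ≠ 0 := fun h => h0 (H.eq_zero_of_leftLim_eq_zero hz hul h)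
        filter_upwards [(H.w_left hz).eventually_ne hwl] with y hy h using hy h.2
      · filter_upwards [(H.u_left hz).eventually_ne hul] with y hy h using hy h.1
    · by_cases hur : rightLim u z = 0
      · have hwr : rightLim w z ≠ 0 := fun h => h0 (H.eq_zero_of_rightLim_eq_zero hz hur h)
        filter_upwards [(H.w_right hz).eventually_ne hwr] with y hy h using hy h.2
      · filter_upwards [(H.u_right hz).eventually_ne hur] with y hy h using hy h.1
  have hU : IsOpen {z ∈ I | u z = 0 ∧ w z = 0} := isOpen_iff_mem_nhds.2 fun z hz =>
    (H.isOpen.eventually_mem hz.1).and (hzero z hz.1 hz.2)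
  have hV : IsOpen {z ∈ I | ¬ (u z = 0 ∧ w z = 0)} := isOpen_iff_mem_nhds.2 fun z hz =>
    (H.isOpen.eventually_mem hz.1).and (hlim z hz.1 hz.2)
  have hsub := H.ordConnected.isPreconnected.subset_left_of_subset_union hU hV
    (disjoint_left.2 fun z hz hz' => hz'.2 hz.2)
    (fun z hz => (em (u z = 0 ∧ w z = 0)).imp (fun h => ⟨hz, h⟩) (fun h => ⟨hz, h⟩))
    ⟨x, hx, hx, hu, hw⟩
  exact fun z hz => (hsub hz).2

theorem eventually_right_pos (H : HomSolData I r α β u w) (hx : x ∈ I)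
    (h : 0 < rightLim u x ∨ rightLim u x = 0 ∧ 0 < rightLim w x) :
    ∀ᶠ y in 𝓝[>] x, 0 < leftLim u y ∧ 0 < rightLim u y := by
  have hlim := (H.u_right hx).rightLim_nhdsWithin isOpen_Ioi
  rcases h with h | ⟨hu, hw⟩
  · exact (((H.u_right hx).leftLim_nhdsWithin isOpen_Ioi).eventually (lt_mem_nhds h)).and
      (hlim.eventually (lt_mem_nhds h))
  · rw [hu] at hlim
    obtain ⟨q, hq, hqI⟩ := mem_nhdsGT_iff_exists_Ioo_subset.1
      (((H.w_right hx).eventually (lt_mem_nhds hw)).and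
        (mem_nhdsWithin_of_mem_nhds (H.isOpen.mem_nhds hx)))
    have hmono := H.rightLim_u_strictMonoOn (fun z hz => (hqI hz).2) (fun z hz => (hqI hz).1)
    have hpos : ∀ y ∈ Ioo x q, 0 < rightLim u y := by
      intro y hy
      obtain ⟨m, hm⟩ := exists_between hy.1
      have hmq : m ∈ Ioo x q := ⟨hm.1, hm.2.trans hy.2⟩
      refine lt_of_le_of_lt (le_of_tendsto hlim ?_) (hmono hmq hy hm.2)
      filter_upwards [Ioo_mem_nhdsGT hm.1] with z hz
      exact (hmono ⟨hz.1, hz.2.trans hmq.2⟩ hmq hz.2).le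
    filter_upwards [Ioo_mem_nhdsGT hq] with y hy
    refine ⟨?_, hpos y hy⟩
    obtain ⟨m, hm⟩ := exists_between hy.1
    have hmq : m ∈ Ioo x q := ⟨hm.1, hm.2.trans hy.2⟩
    refine (hpos m hmq).trans_le
      (ge_of_tendsto ((H.u_left (hqI hy).2).rightLim_nhdsWithin isOpen_Iio) ?_)
    filter_upwards [Ioo_mem_nhdsLT hm.2] with z hz
    exact (hmono hmq ⟨hmq.1.trans hz.1, hz.2.trans hy.2⟩ hz.1).le

theorem eventually_left_neg (H : HomSolData I r α β u w) (hx : x ∈ I)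
    (h : leftLim u x < 0 ∨ leftLim u x = 0 ∧ 0 < leftLim w x) :
    ∀ᶠ y in 𝓝[<] x, leftLim u y < 0 ∧ rightLim u y < 0 := by
  have hlim := (H.u_left hx).rightLim_nhdsWithin isOpen_Iio
  rcases h with h | ⟨hu, hw⟩
  · exact (((H.u_left hx).leftLim_nhdsWithin isOpen_Iio).eventually (gt_mem_nhds h)).and
      (hlim.eventually (gt_mem_nhds h))
  · rw [hu] at hlim
    obtain ⟨p, hp, hpI⟩ := mem_nhdsLT_iff_exists_Ioo_subset.1
      (((H.w_left hx).eventually (lt_mem_nhds hw)).and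
        (mem_nhdsWithin_of_mem_nhds (H.isOpen.mem_nhds hx)))
    have hmono := H.rightLim_u_strictMonoOn (fun z hz => (hpI hz).2) (fun z hz => (hpI hz).1)
    have hneg : ∀ y ∈ Ioo p x, rightLim u y < 0 := by
      intro y hy
      obtain ⟨m, hm⟩ := exists_between hy.2
      have hmp : m ∈ Ioo p x := ⟨hy.1.trans hm.1, hm.2⟩
      refine (hmono hy hmp hm.1).trans_le (ge_of_tendsto hlim ?_)
      filter_upwards [Ioo_mem_nhdsLT hm.2] with z hz
      exact (hmono hmp ⟨hmp.1.trans hz.1, hz.2⟩ hz.1).le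
    filter_upwards [Ioo_mem_nhdsLT hp] with y hy
    refine ⟨?_, hneg y hy⟩
    refine lt_of_le_of_lt
      (le_of_tendsto ((H.u_left (hpI hy).2).rightLim_nhdsWithin isOpen_Iio) ?_) (hneg y hy)
    filter_upwards [Ioo_mem_nhdsLT hy.1] with z hz
    exact (hmono ⟨hz.1, hz.2.trans hy.2⟩ hy hz.2).le

theorem eventually_right_neg (H : HomSolData I r α β u w) (hx : x ∈ I)
    (h : rightLim u x < 0 ∨ rightLim u x = 0 ∧ rightLim w x < 0) :
    ∀ᶠ y in 𝓝[>] x, leftLim u y < 0 ∧ rightLim u y < 0 := by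
  have hneg := H.neg.eventually_right_pos hx (by
    rwa [rightLim_neg (H.u_right hx), rightLim_neg (H.w_right hx), neg_pos, neg_pos, neg_eq_zero])
  filter_upwards [hneg, mem_nhdsWithin_of_mem_nhds (H.isOpen.mem_nhds hx)] with y hy hyI
  rwa [rightLim_neg (H.u_right hyI), leftLim_neg (H.u_left hyI), neg_pos, neg_pos] at hy

theorem eventually_left_pos (H : HomSolData I r α β u w) (hx : x ∈ I)
    (h : 0 < leftLim u x ∨ leftLim u x = 0 ∧ leftLim w x < 0) :
    ∀ᶠ y in 𝓝[<] x, 0 < leftLim u y ∧ 0 < rightLim u y := by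
  have hneg := H.neg.eventually_left_neg hx (by
    rwa [leftLim_neg (H.u_left hx), leftLim_neg (H.w_left hx), neg_pos, neg_lt_zero, neg_eq_zero])
  filter_upwards [hneg, mem_nhdsWithin_of_mem_nhds (H.isOpen.mem_nhds hx)] with y hy hyI
  rwa [rightLim_neg (H.u_right hyI), leftLim_neg (H.u_left hyI), neg_lt_zero, neg_lt_zero] at hy

theorem right_pos_or_neg (H : HomSolData I r α β u w) (hx : x ∈ I)
    (h0 : ¬ (u x = 0 ∧ w x = 0)) :
    (∀ᶠ y in 𝓝[>] x, 0 < leftLim u y ∧ 0 < rightLim u y) ∨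
      ∀ᶠ y in 𝓝[>] x, leftLim u y < 0 ∧ rightLim u y < 0 := by
  rcases lt_trichotomy (rightLim u x) 0 with hu | hu | hu
  · exact Or.inr (H.eventually_right_neg hx (Or.inl hu))
  · rcases lt_trichotomy (rightLim w x) 0 with hw | hw | hw
    · exact Or.inr (H.eventually_right_neg hx (Or.inr ⟨hu, hw⟩))
    · exact absurd (H.eq_zero_of_rightLim_eq_zero hx hu hw) h0
    · exact Or.inl (H.eventually_right_pos hx (Or.inr ⟨hu, hw⟩))
  · exact Or.inl (H.eventually_right_pos hx (Or.inl hu))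

theorem left_pos_or_neg (H : HomSolData I r α β u w) (hx : x ∈ I)
    (h0 : ¬ (u x = 0 ∧ w x = 0)) :
    (∀ᶠ y in 𝓝[<] x, 0 < leftLim u y ∧ 0 < rightLim u y) ∨
      ∀ᶠ y in 𝓝[<] x, leftLim u y < 0 ∧ rightLim u y < 0 := by
  rcases lt_trichotomy (leftLim u x) 0 with hu | hu | hu
  · exact Or.inr (H.eventually_left_neg hx (Or.inl hu))
  · rcases lt_trichotomy (leftLim w x) 0 with hw | hw | hw
    · exact Or.inl (H.eventually_left_pos hx (Or.inr ⟨hu, hw⟩))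
    · exact absurd (H.eq_zero_of_leftLim_eq_zero hx hu hw) h0
    · exact Or.inr (H.eventually_left_neg hx (Or.inr ⟨hu, hw⟩))
  · exact Or.inl (H.eventually_left_pos hx (Or.inl hu))

theorem pos_of_eventually_pos (H : HomSolData I r α β u w) (hx : x ∈ I)
    (h0 : ¬ (u x = 0 ∧ w x = 0))
    (hp : ∀ᶠ y in 𝓝[≠] x, 0 < leftLim u y ∧ 0 < rightLim u y) : 0 < u x := by
  rw [← nhdsLT_sup_nhdsGT, eventually_sup] at hp
  obtain ⟨hpl, hpr⟩ := hp
  have hL : 0 ≤ leftLim u x := ge_of_tendsto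
    ((H.u_left hx).rightLim_nhdsWithin isOpen_Iio) (hpl.mono fun y hy => hy.2.le)
  have hR : 0 ≤ rightLim u x := ge_of_tendsto
    ((H.u_right hx).rightLim_nhdsWithin isOpen_Ioi) (hpr.mono fun y hy => hy.2.le)
  have hr := H.r_mem
  have hbal := H.sol.1.2 x hx
  have hjump := H.jump_u hx
  have hα := H.jump_α_nonneg hx
  have h1r : 0 ≤ 1 - r := sub_nonneg.2 hr.2
  have hux : 0 ≤ u x := by
    rw [hbal]
    exact add_nonneg (mul_nonneg hr.1 hL) (mul_nonneg h1r hR)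
  rcases hux.lt_or_eq with h | h
  · exact h
  exfalso
  obtain ⟨hwl, hwr⟩ := H.lims_eq_of_eq_zero hx h.symm
  have hw0 : w x ≠ 0 := fun hw => h0 ⟨h.symm, hw⟩
  rcases lt_or_gt_of_ne hw0 with hw | hw
  · have hle : rightLim u x ≤ leftLim u x := by nlinarith
    rcases hR.lt_or_eq with hR' | hR'
    · nlinarith [mul_nonneg hr.1 (sub_nonneg.2 hle)]
    · obtain ⟨y, hy, hy'⟩ :=
        (hpr.and (H.eventually_right_neg hx (Or.inr ⟨hR'.symm, hwr ▸ hw⟩))).exists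
      exact lt_asymm hy.1 hy'.1
  · have hle : leftLim u x ≤ rightLim u x := by nlinarith
    rcases hL.lt_or_eq with hL' | hL'
    · nlinarith [mul_nonneg h1r (sub_nonneg.2 hle)]
    · obtain ⟨y, hy, hy'⟩ :=
        (hpl.and (H.eventually_left_neg hx (Or.inr ⟨hL'.symm, hwl ▸ hw⟩))).exists
      exact lt_asymm hy.1 hy'.1

end HomSolData

theorem exists_Ioo_of_eventually {I : Set ℝ} (hI : IsOpen I) {x : ℝ} (hx : x ∈ I)
    {p q : ℝ → Prop} (hp : ∀ᶠ y in 𝓝[<] x, p y) (hq : ∀ᶠ y in 𝓝[>] x, q y) :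
    ∃ δ > 0, Ioo (x - δ) (x + δ) ⊆ I ∧ (∀ y ∈ Ioo (x - δ) x, p y) ∧
      ∀ y ∈ Ioo x (x + δ), q y := by
  obtain ⟨δ, hδ, h⟩ := Metric.eventually_nhds_iff.1
    ((hI.eventually_mem hx).and
      ((eventually_nhdsWithin_iff.1 hp).and (eventually_nhdsWithin_iff.1 hq)))
  refine ⟨δ, hδ, fun y hy => (h ?_).1, fun y hy => (h ?_).2.1 hy.2, fun y hy => (h ?_).2.2 hy.1⟩
  all_goals
    rw [Real.dist_eq, abs_lt]
    constructor <;> linarith [hy.1, hy.2]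

theorem isOpen_eventually_nhdsNE {I : Set ℝ} (hI : IsOpen I) (p : ℝ → Prop) :
    IsOpen {x ∈ I | ∀ᶠ y in 𝓝[≠] x, p y} := by
  refine isOpen_iff_mem_nhds.2 fun x hx => ?_
  have h := (eventually_nhdsWithin_iff.1 hx.2).eventually_nhds
  filter_upwards [hI.mem_nhds hx.1, h] with y hyI hy
  refine ⟨hyI, ?_⟩
  rcases eq_or_ne y x with rfl | hyx
  · exact hx.2
  · exact mem_nhdsWithin_of_mem_nhds ((hy.and (eventually_ne_nhds hyx)).mono fun z hz => hz.1 hz.2)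

theorem isOpen_EI (a b : EReal) : IsOpen (EI a b) :=
  isOpen_Ioo.preimage continuous_coe_real_ereal

theorem ordConnected_EI (a b : EReal) : (EI a b).OrdConnected :=
  ⟨fun _ hx _ hy _ hz => ⟨hx.1.trans_le (EReal.coe_le_coe_iff.2 hz.1),
    (EReal.coe_le_coe_iff.2 hz.2).trans_lt hy.2⟩⟩

theorem HomSolData.pos_or_neg_of_not_changesSignAt {I : Set ℝ} {r : ℝ} {α β u w : ℝ → ℝ}
    (H : HomSolData I r α β u w) (hnt : ¬ ∀ x ∈ I, u x = 0)
    (hns : ¬ ∃ s ∈ I, ChangesSignAt I u s) :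
    (∀ x ∈ I, 0 < u x) ∨ ∀ x ∈ I, u x < 0 := by
  have h0 : ∀ x ∈ I, ¬ (u x = 0 ∧ w x = 0) := fun x hx h =>
    hnt fun z hz => (H.eq_zero_of_eq_zero_at hx h.1 h.2 z hz).1
  have hcover : ∀ x ∈ I, (∀ᶠ y in 𝓝[≠] x, 0 < leftLim u y ∧ 0 < rightLim u y) ∨
      ∀ᶠ y in 𝓝[≠] x, leftLim u y < 0 ∧ rightLim u y < 0 := by
    intro x hx
    simp only [← nhdsLT_sup_nhdsGT, eventually_sup]
    rcases H.left_pos_or_neg hx (h0 x hx) with hl | hl <;>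
      rcases H.right_pos_or_neg hx (h0 x hx) with hr | hr
    · exact Or.inl ⟨hl, hr⟩
    · obtain ⟨δ, hδ, hI, hp, hq⟩ := exists_Ioo_of_eventually H.isOpen hx hl hr
      exact absurd ⟨x, hx, δ, hδ, hI,
        Or.inr ⟨fun y hy => (hp y hy).1, fun y hy => (hq y hy).2⟩⟩ hns
    · obtain ⟨δ, hδ, hI, hp, hq⟩ := exists_Ioo_of_eventually H.isOpen hx hl hr
      exact absurd ⟨x, hx, δ, hδ, hI,
        Or.inl ⟨fun y hy => (hp y hy).1, fun y hy => (hq y hy).2⟩⟩ hns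
    · exact Or.inr ⟨hl, hr⟩
  rcases (isPreconnected_iff_subset_of_disjoint.1 H.ordConnected.isPreconnected) _ _
    (isOpen_eventually_nhdsNE H.isOpen fun y => 0 < leftLim u y ∧ 0 < rightLim u y)
    (isOpen_eventually_nhdsNE H.isOpen fun y => leftLim u y < 0 ∧ rightLim u y < 0)
    (fun x hx => (hcover x hx).imp (fun h => ⟨hx, h⟩) (fun h => ⟨hx, h⟩))
    (eq_empty_of_forall_notMem fun x hx => by
      obtain ⟨y, hy, hy'⟩ := (hx.2.1.2.and hx.2.2.2).exists
      exact lt_asymm hy.1 hy'.1) with h | h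
  · exact Or.inl fun x hx => H.pos_of_eventually_pos hx (h0 x hx) (h hx).2
  · refine Or.inr fun x hx => neg_pos.1 (H.neg.pos_of_eventually_pos hx (by simpa using h0 x hx) ?_)
    filter_upwards [(h hx).2, mem_nhdsWithin_of_mem_nhds (H.isOpen.mem_nhds hx)] with y hy hyI
    rwa [rightLim_neg (H.u_right hyI), leftLim_neg (H.u_left hyI), neg_pos, neg_pos]

theorem not_changesSignAt_of_pos_or_neg {I : Set ℝ} (hI : IsOpen I) {u : ℝ → ℝ}
    (hu : (∀ x ∈ I, 0 < u x) ∨ ∀ x ∈ I, u x < 0) (s : ℝ) : ¬ ChangesSignAt I u s := by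
  rintro ⟨δ, hδ, hδI, h⟩
  have hl : s - δ / 2 ∈ Ioo (s - δ) s := ⟨by linarith, by linarith⟩
  have hr : s + δ / 2 ∈ Ioo s (s + δ) := ⟨by linarith, by linarith⟩
  have hlI : s - δ / 2 ∈ I := hδI ⟨hl.1, by linarith⟩
  have hrI : s + δ / 2 ∈ I := hδI ⟨by linarith, hr.2⟩
  rcases hu with hu | hu
  · have hL := leftLim_mem_of_isClosed hI isClosed_Ici (fun z hz => (hu z hz).le) hlI
    have hR := rightLim_mem_of_isClosed hI isClosed_Ici (fun z hz => (hu z hz).le) hrI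
    rcases h with h | h
    · exact (h.1 _ hl).not_ge hL
    · exact (h.2 _ hr).not_ge hR
  · have hL := leftLim_mem_of_isClosed hI isClosed_Iic (fun z hz => (hu z hz).le) hlI
    have hR := rightLim_mem_of_isClosed hI isClosed_Iic (fun z hz => (hu z hz).le) hrI
    rcases h with h | h
    · exact (h.2 _ hr).not_ge hR
    · exact (h.1 _ hl).not_ge hL

/-- Theorem 4.8: a nontrivial real-valued `r`-balanced solution `u` of
`-d(dy/dα) + y dβ = 0` does not change sign in `(a,b)` iff `u > 0` on `(a,b)` or `u < 0`
on `(a,b)`. -/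
theorem statement8 (a b : EReal) (hab : a < b) (r : ℝ) (hr : r ∈ Icc (0 : ℝ) 1)
    (α β : ℝ → ℝ) (hα : StrictMonoOn α (EI a b))
    (hβ : LocallyBoundedVariationOn β (EI a b))
    (hθ : ∀ x ∈ EI a b, theta α β (1 - r) x ≠ 0 ∧ theta α β r x ≠ 0)
    (u w : ℝ → ℝ) (hsol : IsHomSol (EI a b) r α β u w)
    (hnt : ¬ ∀ x ∈ EI a b, u x = 0) :
    (¬ ∃ s ∈ EI a b, ChangesSignAt (EI a b) u s) ↔
      ((∀ x ∈ EI a b, 0 < u x) ∨ (∀ x ∈ EI a b, u x < 0)) := by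
  have H : HomSolData (EI a b) r α β u w :=
    ⟨isOpen_EI a b, ordConnected_EI a b, hr, hα, hβ, hθ, hsol⟩
  refine ⟨H.pos_or_neg_of_not_changesSignAt hnt, ?_⟩
  rintro hu ⟨s, -, hs⟩
  exact not_changesSignAt_of_pos_or_neg H.isOpen hu s hs
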